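/- Let Γ be a finite normal-form game with identical interests and let C be a permutation-invariant partition of the player set. Let (q(t), q̄(t)) be any discrete-time ECFP process with respect to (Γ, C) (step sizes γ_t ≥ 0 with ∑_t γ_t = ∞ and γ_t → 0, and best-response perturbations ε_t → 0). Then the empirical distributions learn mean-centric equilibria: dist(q(t), MCE) → 0 as t → ∞. -/

import Mathlib

open MeasureTheory Filter Topology

noncomputable section

namespace ECFP

variable {ι A κ : Type*}

/-- The mixed-strategy simplex over a finite action set `Y` inside the action universe `A`. -/
def simplex (Y : Finset A) : Set (A → ℝ) :=
  {p | (∀ a, 0 ≤ p a) ∧ (∀ a, a ∉ Y → p a = 0) ∧ ∑ a ∈ Y, p a = 1}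

/-- The space `Δⁿ` of joint mixed strategies. -/
def Delta (Y : ι → Finset A) : Set (ι → A → ℝ) :=
  {p | ∀ i, p i ∈ simplex (Y i)}

variable [Fintype ι] [DecidableEq ι] [Fintype A] [DecidableEq κ]

/-- The mixed extension of the common utility `u`:
`U(p₁,…,pₙ) = ∑_y u(y) p₁(y₁)⋯pₙ(yₙ)`. -/
def U (u : (ι → A) → ℝ) (p : ι → A → ℝ) : ℝ :=
  ∑ y : ι → A, u y * ∏ i, p i (y i)

/-- The `ε`-best-response set of player `i` against the joint strategy `p`
(only the components `p_{-i}` matter, since player `i`'s component is overwritten):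
`{pᵢ ∈ Δᵢ : U(pᵢ,p_{-i}) ≥ U(qᵢ,p_{-i}) - ε  ∀ qᵢ ∈ Δᵢ}`. -/
def BRi (Y : ι → Finset A) (u : (ι → A) → ℝ) (ε : ℝ) (p : ι → A → ℝ) (i : ι) :
    Set (A → ℝ) :=
  {pi | pi ∈ simplex (Y i) ∧
    ∀ qi ∈ simplex (Y i),
      U u (Function.update p i pi) ≥ U u (Function.update p i qi) - ε}

/-- The joint `ε`-best-response set `BR^ε(p) = (BR₁^ε(p_{-1}),…,BRₙ^ε(p_{-n}))`. -/
def BR (Y : ι → Finset A) (u : (ι → A) → ℝ) (ε : ℝ) (p : ι → A → ℝ) :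
    Set (ι → A → ℝ) :=
  {b | ∀ i, b i ∈ BRi Y u ε p i}

/-- The profile obtained from `y` by swapping the strategies of players `i` and `j`. -/
def swapStrat (y : ι → A) (i j : ι) : ι → A :=
  Function.update (Function.update y i (y j)) j (y i)

/-- `cls : ι → κ` encodes a permutation-invariant partition of the player set (the classes
are the fibers of `cls`): players in the same class have the same action set, and the utility
is invariant under swapping the strategies of two same-class players in any strategy profile. -/
def PermInvariant (Y : ι → Finset A) (u : (ι → A) → ℝ) (cls : ι → κ) : Prop :=
  ∀ i j : ι, cls i = cls j →
    Y i = Y j ∧ ∀ y : ι → A, (∀ k, y k ∈ Y k) → u (swapStrat y i j) = u y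

/-- The equivalence class (as a finset of players) of player `i`. -/
def cluster (cls : ι → κ) (i : ι) : Finset ι :=
  Finset.univ.filter (fun j => cls j = cls i)

/-- The centroid distribution `p̄`: player `i` is assigned the average of the strategies of
the players in `i`'s class. -/
def centroid (cls : ι → κ) (p : ι → A → ℝ) : ι → A → ℝ :=
  fun i => ((cluster cls i).card : ℝ)⁻¹ • ∑ j ∈ cluster cls i, p j

/-- A joint strategy is class-constant if same-class players use identical strategies. -/
def classConst (cls : ι → κ) (p : ι → A → ℝ) : Prop :=
  ∀ i j, cls i = cls j → p i = p j

/-- The set of Nash equilibria. -/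
def NE (Y : ι → Finset A) (u : (ι → A) → ℝ) : Set (ι → A → ℝ) :=
  {p | p ∈ Delta Y ∧ ∀ i, ∀ qi ∈ simplex (Y i),
    U u (Function.update p i qi) ≤ U u p}

/-- The set of symmetric Nash equilibria relative to the partition `cls`. -/
def SNE (Y : ι → Finset A) (u : (ι → A) → ℝ) (cls : ι → κ) : Set (ι → A → ℝ) :=
  {p | p ∈ NE Y u ∧ classConst cls p}

/-- The set of mean-centric equilibria relative to the partition `cls`:
`U(pᵢ, p̄_{-i}) ≥ U(pᵢ', p̄_{-i})` for all `pᵢ' ∈ Δᵢ` and all `i`. -/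
def MCE (Y : ι → Finset A) (u : (ι → A) → ℝ) (cls : ι → κ) : Set (ι → A → ℝ) :=
  {p | p ∈ Delta Y ∧ ∀ i, ∀ qi ∈ simplex (Y i),
    U u (Function.update (centroid cls p) i qi)
      ≤ U u (Function.update (centroid cls p) i (p i))}

/-- `V(p) = (1/n) ∑ᵢ U(pᵢ, p̄_{-i})`. -/
def Vfun (u : (ι → A) → ℝ) (cls : ι → κ) (p : ι → A → ℝ) : ℝ :=
  (Fintype.card ι : ℝ)⁻¹ * ∑ i, U u (Function.update (centroid cls p) i (p i))

/-- A discrete-time ECFP process w.r.t. `(Γ, 𝒞)`: `q(1) = a(1)`,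
`q(t+1) = q(t) + γₜ (a(t+1) − q(t))` and `a(t+1) ∈ BR^{εₜ}(q̄(t))` for all `t`
(time is indexed by `ℕ`, i.e. `t = 0` plays the role of `t = 1` in the paper). -/
structure IsECFP (Y : ι → Finset A) (u : (ι → A) → ℝ) (cls : ι → κ)
    (γ ε : ℕ → ℝ) (a q : ℕ → ι → A → ℝ) : Prop where
  a_init_mem : a 0 ∈ Delta Y
  q_mem : ∀ t, q t ∈ Delta Y
  init : q 0 = a 0
  step : ∀ t, q (t + 1) = q t + γ t • (a (t + 1) - q t)
  br : ∀ t, a (t + 1) ∈ BR Y u (ε t) (centroid cls (q t))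

/-- A solution of the differential inclusion `ẋ ∈ F(x)` taking values in `Δⁿ`:
an everywhere-`Δⁿ`-valued trajectory on `[0,∞)` which is the integral of a locally
integrable selection `g(t) ∈ F(x(t))` (a.e.). -/
def IsSolution (Y : ι → Finset A) (F : (ι → A → ℝ) → Set (ι → A → ℝ))
    (x : ℝ → ι → A → ℝ) : Prop :=
  (∀ t : ℝ, 0 ≤ t → x t ∈ Delta Y) ∧
  ∃ g : ℝ → ι → A → ℝ,
    LocallyIntegrableOn g (Set.Ici (0 : ℝ)) ∧
    (∀ᵐ t ∂(volume.restrict (Set.Ici (0 : ℝ))), g t ∈ F (x t)) ∧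
    ∀ t : ℝ, 0 ≤ t → x t = x 0 + ∫ s in Set.Ioc (0 : ℝ) t, g s

/-- Right-hand side of the joint CT-ECFP differential inclusion `q̇ ∈ BR(q̄) − q`. -/
def Fjoint (Y : ι → Finset A) (u : (ι → A) → ℝ) (cls : ι → κ)
    (q : ι → A → ℝ) : Set (ι → A → ℝ) :=
  (fun b => b - q) '' BR Y u 0 (centroid cls q)

/-- Right-hand side of the centroid CT-ECFP differential inclusion `ẏ ∈ BR(y) − y`. -/
def Fcent (Y : ι → Finset A) (u : (ι → A) → ℝ)
    (y : ι → A → ℝ) : Set (ι → A → ℝ) :=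
  (fun b => b - y) '' BR Y u 0 y

/-- The ω-limit set of a continuous-time trajectory: all limits of sequences
`x(t_k)` with `t_k → ∞`. -/
def omegaLimitSet (x : ℝ → ι → A → ℝ) : Set (ι → A → ℝ) :=
  {p | ∃ tk : ℕ → ℝ, Tendsto tk atTop atTop ∧ Tendsto (fun k => x (tk k)) atTop (𝓝 p)}

/-- The set of limit points of a (discrete-time) sequence. -/
def seqLimitPoints (q : ℕ → ι → A → ℝ) : Set (ι → A → ℝ) :=
  {p | ∃ φ : ℕ → ℕ, StrictMono φ ∧ Tendsto (fun k => q (φ k)) atTop (𝓝 p)}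

/-- A compact set `X ⊆ Δⁿ` is internally chain transitive for the inclusion `ẋ ∈ F(x)`:
any two points of `X` can be joined, for every `ε > 0` and `T > 0`, by finitely many
solution pieces of duration `> T` staying in `X`, with jumps of size `≤ ε`. -/
def InternallyChainTransitive (Y : ι → Finset A)
    (F : (ι → A → ℝ) → Set (ι → A → ℝ)) (X : Set (ι → A → ℝ)) : Prop :=
  IsCompact X ∧ X ⊆ Delta Y ∧
  ∀ ξ ∈ X, ∀ η ∈ X, ∀ ε : ℝ, 0 < ε → ∀ T : ℝ, 0 < T →
    ∃ k : ℕ, 0 < k ∧ ∃ x : ℕ → ℝ → ι → A → ℝ, ∃ tt : ℕ → ℝ,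
      (∀ i < k, IsSolution Y F (x i)) ∧
      (∀ i < k, T < tt i) ∧
      (∀ i < k, ∀ s : ℝ, 0 ≤ s → s ≤ tt i → x i s ∈ X) ∧
      (∀ i, i + 1 < k → ‖x i (tt i) - x (i + 1) 0‖ ≤ ε) ∧
      ‖x 0 0 - ξ‖ ≤ ε ∧ ‖x (k - 1) (tt (k - 1)) - η‖ ≤ ε

open KaehlerDifferential in
lemma isAlgebraic_of_D_eq_zero {k K : Type*} [Field k] [CharZero k] [Field K] [Algebra k K]
    [Algebra.EssFiniteType k K] {x : K} (h : D k K x = 0) : IsAlgebraic k x := by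
  by_contra hx
  have hinj : Function.Injective (Polynomial.aeval x : Polynomial k →ₐ[k] K) :=
    transcendental_iff_injective.mp hx
  let _ : Algebra (Polynomial k) K := (Polynomial.aeval x).toAlgebra
  have : FaithfulSMul (Polynomial k) K := (faithfulSMul_iff_algebraMap_injective _ _).mpr hinj
  have : IsScalarTower k (Polynomial k) K := .of_algebraMap_eq' (Polynomial.aeval x).comp_algebraMap.symm
  let L := FractionRing (Polynomial k)
  let _ : Algebra L K := FractionRing.liftAlgebra (Polynomial k) K
  have : IsScalarTower (Polynomial k) L K := FractionRing.isScalarTower_liftAlgebra _ _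
  have : IsScalarTower k L K := .to₁₃₄ k (Polynomial k) L K
  have : Algebra.EssFiniteType L K := .of_comp k L K
  have : CharZero L := charZero_of_injective_algebraMap (algebraMap k L).injective
  have : Algebra.FormallySmooth (Polynomial k) L := .of_isLocalization (nonZeroDivisors _)
  have : Algebra.FormallySmooth (Polynomial k) K := .comp _ L K
  have hD : mapBaseChange k (Polynomial k) K (1 ⊗ₜ D k (Polynomial k) .X) = 0 := by
    rw [mapBaseChange_tmul, map_D, one_smul]
    convert h
    exact Polynomial.aeval_X x
  obtain ⟨z, hz⟩ := (Algebra.H1Cotangent.exact_δ_mapBaseChange k (Polynomial k) K _).mp hD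
  rw [Subsingleton.elim z 0, map_zero] at hz
  have := congrArg (TensorProduct.rid (Polynomial k) K ∘
    (polynomialEquiv k).toLinearMap.lTensor K) hz
  simp at this

open MvPolynomial in
lemma derivation_algebraMap_mvPolynomial {R B M σ : Type*} [CommRing R] [CommRing B] [Algebra R B]
    [Algebra (MvPolynomial σ R) B] [IsScalarTower R (MvPolynomial σ R) B]
    [AddCommGroup M] [Module B M] [Module R M] [IsScalarTower R B M] [Fintype σ]
    (D : Derivation R B M) (p : MvPolynomial σ R) :
    D (algebraMap _ B p) =
      ∑ s, algebraMap _ B (pderiv s p) • D (algebraMap (MvPolynomial σ R) B (X s)) := by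
  classical
  induction p using MvPolynomial.induction_on with
  | C r =>
    have : algebraMap (MvPolynomial σ R) B (C r) = algebraMap R B r :=
      (IsScalarTower.algebraMap_apply R (MvPolynomial σ R) B r).symm
    simp [this]
  | add p q hp hq => simp [hp, hq, add_smul, Finset.sum_add_distrib]
  | mul_X p s hp =>
    simp [hp, add_smul, Finset.sum_add_distrib, mul_smul, Finset.smul_sum, pderiv_X, Pi.single_apply,
      apply_ite (algebraMap _ B), ite_smul]

lemma exists_aeval_mem_of_D_eq_zero {k σ : Type*} [Field k] [CharZero k] [Finite σ]
    (J : Ideal (MvPolynomial σ k)) (f : MvPolynomial σ k)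
    (h : ∀ (p : Ideal (MvPolynomial σ k)) [p.IsPrime], J ≤ p →
      KaehlerDifferential.D k p.ResidueField (algebraMap _ p.ResidueField f) = 0) :
    ∃ P : Polynomial k, P ≠ 0 ∧ Polynomial.aeval f P ∈ J := by
  by_contra! hJ
  obtain ⟨p, hp, hJp, hdisj⟩ := J.exists_le_prime_disjoint
    ((nonZeroDivisors (Polynomial k)).map (Polynomial.aeval f : Polynomial k →ₐ[k] _))
    (Set.disjoint_left.mpr (by
      rintro _ hx ⟨P, hP, rfl⟩
      exact hJ P (nonZeroDivisors.ne_zero hP) hx))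
  have : Algebra.EssFiniteType k p.ResidueField := .comp k (MvPolynomial σ k) _
  obtain ⟨P, hP0, hP⟩ := isAlgebraic_of_D_eq_zero (h p hJp)
  rw [Polynomial.aeval_algebraMap_apply, Ideal.algebraMap_residueField_eq_zero] at hP
  exact Set.disjoint_left.mp hdisj hP ⟨P, mem_nonZeroDivisors_of_ne_zero hP0, rfl⟩

/-- The payoff of player `i` for the pure action `a` against `p`. -/
def payoff [DecidableEq A] (u : (ι → A) → ℝ) (p : ι → A → ℝ) (i : ι) (a : A) : ℝ :=
  U u (Function.update p i (Pi.single a 1))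

lemma U_update (u : (ι → A) → ℝ) (p : ι → A → ℝ) (i : ι) (α : A → ℝ) :
    U u (Function.update p i α) =
      ∑ y : ι → A, u y * ((∏ j ∈ Finset.univ.erase i, p j (y j)) * α (y i)) := by
  refine Finset.sum_congr rfl fun y _ => ?_
  rw [← Finset.prod_erase_mul _ _ (Finset.mem_univ i), Function.update_self]
  congr 2
  refine Finset.prod_congr rfl fun j hj => ?_
  rw [Function.update_of_ne (Finset.ne_of_mem_erase hj)]

lemma U_update_eq_sum_payoff [DecidableEq A] (u : (ι → A) → ℝ) (p : ι → A → ℝ) (i : ι)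
    (α : A → ℝ) : U u (Function.update p i α) = ∑ a, α a * payoff u p i a := by
  simp only [payoff, U_update, Finset.mul_sum]
  rw [Finset.sum_comm]
  refine Finset.sum_congr rfl fun y _ => ?_
  simp [Pi.single_apply]
  ring

/-- The common utility as a polynomial in the probabilities. -/
def utilityPoly (u : (ι → A) → ℝ) : MvPolynomial (ι × A) ℝ :=
  ∑ y : ι → A, .C (u y) * ∏ i, .X (i, y i)

lemma aeval_utilityPoly (u : (ι → A) → ℝ) (p : ι → A → ℝ) :
    MvPolynomial.aeval (Function.uncurry p) (utilityPoly u) = U u p := by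
  simp [utilityPoly, U, map_prod]

lemma aeval_pderiv_utilityPoly [DecidableEq A] (u : (ι → A) → ℝ) (p : ι → A → ℝ) (i : ι) (a : A) :
    MvPolynomial.aeval (Function.uncurry p) (MvPolynomial.pderiv (i, a) (utilityPoly u)) =
      payoff u p i a := by
  simp only [utilityPoly, payoff, U_update, map_sum]
  refine Finset.sum_congr rfl fun y _ => ?_
  have hzero : MvPolynomial.pderiv (i, a)
      (∏ j ∈ Finset.univ.erase i, (.X (j, y j) : MvPolynomial (ι × A) ℝ)) = 0 := by
    refine Finset.prod_induction _ (fun P => MvPolynomial.pderiv (i, a) P = 0)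
      (fun P Q hP hQ => by simp [hP, hQ]) (Derivation.map_one_eq_zero _) fun j hj => ?_
    exact MvPolynomial.pderiv_X_of_ne fun h => Finset.ne_of_mem_erase hj (congrArg Prod.fst h)
  rw [MvPolynomial.pderiv_C_mul, ← Finset.prod_erase_mul _ _ (Finset.mem_univ i),
    Derivation.leibniz, hzero, MvPolynomial.pderiv_X]
  by_cases h : y i = a
  · simp [h, map_prod]
  · simp [h]

/-- The ideal of the first-order equilibrium conditions for equilibria with support `S`. -/
def equilibriumIdeal (u : (ι → A) → ℝ) (S : Set (ι × A)) : Ideal (MvPolynomial (ι × A) ℝ) :=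
  Ideal.span ({P | ∃ s ∉ S, P = .X s} ∪ {P | ∃ i, P = ∑ a, .X (i, a) - 1} ∪
    {P | ∃ s ∈ S, P = MvPolynomial.pderiv s (utilityPoly u) - utilityPoly u})

lemma exists_aeval_utilityPoly_mem (u : (ι → A) → ℝ) (S : Set (ι × A)) :
    ∃ P : Polynomial ℝ, P ≠ 0 ∧ Polynomial.aeval (utilityPoly u) P ∈ equilibriumIdeal u S := by
  refine exists_aeval_mem_of_D_eq_zero _ _ fun p _ hp => ?_
  set φ := algebraMap (MvPolynomial (ι × A) ℝ) p.ResidueField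
  have hφ : ∀ P ∈ equilibriumIdeal u S, φ P = 0 := fun P hP =>
    Ideal.algebraMap_residueField_eq_zero.mpr (hp hP)
  have hsum : ∀ i, ∑ a, φ (.X (i, a)) = 1 := fun i => by
    have := hφ _ (Ideal.subset_span (.inl (.inr ⟨i, rfl⟩)))
    rwa [map_sub, map_one, sub_eq_zero, map_sum] at this
  have hterm : ∀ s, φ (MvPolynomial.pderiv s (utilityPoly u)) •
      KaehlerDifferential.D ℝ p.ResidueField (φ (.X s)) =
        φ (utilityPoly u) • KaehlerDifferential.D ℝ p.ResidueField (φ (.X s)) := fun s => by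
    by_cases hs : s ∈ S
    · have := hφ _ (Ideal.subset_span (.inr ⟨s, hs, rfl⟩))
      rw [map_sub, sub_eq_zero] at this
      rw [this]
    · rw [hφ _ (Ideal.subset_span (.inl (.inl ⟨s, hs, rfl⟩)))]
      simp
  rw [derivation_algebraMap_mvPolynomial, Finset.sum_congr rfl fun s _ => hterm s,
    ← Finset.smul_sum, Fintype.sum_prod_type]
  simp only [← map_sum, hsum, Derivation.map_one_eq_zero, Finset.sum_const_zero, smul_zero]

lemma U_eq_update_self (u : (ι → A) → ℝ) (p : ι → A → ℝ) (i : ι) :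
    U u p = U u (Function.update p i (p i)) := by rw [Function.update_eq_self]

lemma simplex_sum_univ {Y : Finset A} {α : A → ℝ} (h : α ∈ simplex Y) : ∑ a, α a = 1 := by
  rw [← h.2.2]
  exact (Finset.sum_subset (Finset.subset_univ _) fun a _ ha => h.2.1 a ha).symm

lemma single_mem_simplex {B : Type*} [DecidableEq B] {Y : Finset B} {a : B} (ha : a ∈ Y) :
    (Pi.single a 1 : B → ℝ) ∈ simplex Y := by
  refine ⟨fun b => ?_, fun b hb => ?_, ?_⟩
  · by_cases h : b = a <;> simp [h]
  · rw [Pi.single_eq_of_ne]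
    rintro rfl
    exact hb ha
  · simp [Pi.single_apply, ha]

lemma payoff_eq_of_mem_NE [DecidableEq A] {Y : ι → Finset A} {u : (ι → A) → ℝ} {p : ι → A → ℝ}
    (hp : p ∈ NE Y u) {i : ι} {a : A} (ha : p i a ≠ 0) : payoff u p i a = U u p := by
  have hle : ∀ b ∈ Finset.univ, p i b * payoff u p i b ≤ p i b * U u p := fun b _ => by
    by_cases hb : b ∈ Y i
    · exact mul_le_mul_of_nonneg_left (hp.2 i _ (single_mem_simplex hb)) ((hp.1 i).1 b)
    · simp [(hp.1 i).2.1 b hb]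
  have hsum : ∑ b, p i b * payoff u p i b = ∑ b, p i b * U u p := by
    rw [← U_update_eq_sum_payoff, ← U_eq_update_self, ← Finset.sum_mul,
      simplex_sum_univ (hp.1 i), one_mul]
  exact mul_left_cancel₀ ha ((Finset.sum_eq_sum_iff_of_le hle).mp hsum a (Finset.mem_univ a))

/-- An identical-interests game has only finitely many equilibrium payoffs. -/
lemma finite_image_U_NE (Y : ι → Finset A) (u : (ι → A) → ℝ) : (U u '' NE Y u).Finite := by
  classical
  choose P hP0 hP using exists_aeval_utilityPoly_mem u
  refine (Set.finite_iUnion fun S : Set (ι × A) => (P S).rootSet_finite ℝ).subset ?_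
  rintro _ ⟨p, hp, rfl⟩
  let S : Set (ι × A) := {s | p s.1 s.2 ≠ 0}
  refine Set.mem_iUnion.mpr ⟨S, Polynomial.mem_rootSet.mpr ⟨hP0 S, ?_⟩⟩
  have hle : equilibriumIdeal u S ≤
      RingHom.ker (MvPolynomial.aeval (Function.uncurry p) : MvPolynomial (ι × A) ℝ →ₐ[ℝ] ℝ) := by
    refine Ideal.span_le.mpr ?_
    rintro _ ((⟨s, hs, rfl⟩ | ⟨i, rfl⟩) | ⟨⟨i, a⟩, hs, rfl⟩)
    · simpa [S, Function.uncurry] using hs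
    · simp [simplex_sum_univ (hp.1 i)]
    · rw [SetLike.mem_coe, RingHom.mem_ker, map_sub, aeval_pderiv_utilityPoly, aeval_utilityPoly,
        payoff_eq_of_mem_NE hp hs, sub_self]
  have := hle (hP S)
  rwa [RingHom.mem_ker, ← Polynomial.aeval_algHom_apply, aeval_utilityPoly] at this

/-- On a compact set, a nonnegative continuous function is bounded away from `0` on any closed
subset that misses its zeros. -/
lemma exists_pos_le_of_isCompact {X : Type*} [TopologicalSpace X] {K : Set X} (hK : IsCompact K)
    {g : X → ℝ} (hg : ContinuousOn g K) (hpos : ∀ x ∈ K, 0 < g x) :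
    ∃ η > 0, ∀ x ∈ K, η ≤ g x := by
  rcases K.eq_empty_or_nonempty with rfl | hne
  · exact ⟨1, one_pos, by simp⟩
  · obtain ⟨x, hx, hmin⟩ := hK.exists_isMinOn hne hg
    exact ⟨g x, hpos x hx, fun y hy => hmin hy⟩

section Lyapunov

variable {X : Type*} [MetricSpace X] {K : Set X} {q : ℕ → X} {W g : X → ℝ} {γ δ : ℕ → ℝ}

lemma tendsto_dist_comp_succ (hK : IsCompact K) (hq : ∀ t, q t ∈ K) (hW : ContinuousOn W K)
    (hγ0 : Tendsto γ atTop (𝓝 0)) (hstep : ∀ᶠ t in atTop, dist (q (t + 1)) (q t) ≤ γ t) {r : ℝ}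
    (hr : 0 < r) : ∀ᶠ t in atTop, |W (q (t + 1)) - W (q t)| < r := by
  obtain ⟨ρ, hρ, h⟩ := Metric.uniformContinuousOn_iff.mp
    (hK.uniformContinuousOn_of_continuous hW) r hr
  filter_upwards [hstep, hγ0.eventually_lt_const hρ] with t h1 h2
  exact h _ (hq _) _ (hq _) (h1.trans_lt h2)

/-- A bounded sequence which eventually almost increases along its Lyapunov function converges in
value as soon as the Lyapunov function has finitely many critical values. -/
lemma exists_tendsto_of_lyapunov (hK : IsCompact K) (hq : ∀ t, q t ∈ K)
    (hW : ContinuousOn W K) (hg : ContinuousOn g K) (hg0 : ∀ x ∈ K, 0 ≤ g x)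
    (hfin : (W '' {x ∈ K | g x = 0}).Finite)
    (hγ : ∀ t, 0 ≤ γ t) (hγ0 : Tendsto γ atTop (𝓝 0)) (hδ : Tendsto δ atTop (𝓝 0))
    (hstep : ∀ᶠ t in atTop, dist (q (t + 1)) (q t) ≤ γ t)
    (hinc : ∀ᶠ t in atTop, γ t * (g (q t) - δ t) ≤ W (q (t + 1)) - W (q t)) :
    ∃ c, Tendsto (fun t => W (q t)) atTop (𝓝 c) := by
  obtain ⟨B, hB⟩ := (hK.image_of_continuousOn hW).isBounded.bddAbove
  obtain ⟨b, hb⟩ := (hK.image_of_continuousOn hW).isBounded.bddBelow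
  refine tendsto_of_no_upcrossings dense_univ (fun c _ d _ hcd => ?_)
    (isBoundedUnder_of ⟨B, fun t => hB ⟨_, hq t, rfl⟩⟩)
    (isBoundedUnder_of ⟨b, fun t => hb ⟨_, hq t, rfl⟩⟩)
  rintro ⟨hlt, hgt⟩
  obtain ⟨m, hm, hmZ⟩ := (Set.Ioo_infinite hcd).exists_notMem_finset hfin.toFinset
  rw [Set.Finite.mem_toFinset] at hmZ
  obtain ⟨r, hr, hball⟩ := Metric.isOpen_iff.mp
    (isOpen_Ioo.sdiff hfin.isClosed) m ⟨hm, hmZ⟩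
  have hIcc : Set.Icc m (m + r / 2) ⊆ Set.Ioo c d \ W '' {x ∈ K | g x = 0} := fun x hx =>
    hball (by rw [Metric.mem_ball, Real.dist_eq, abs_lt]; constructor <;> linarith [hx.1, hx.2])
  have hcpt : IsCompact (K ∩ W ⁻¹' Set.Icc m (m + r / 2)) :=
    hK.of_isClosed_subset (hW.preimage_isClosed_of_isClosed hK.isClosed isClosed_Icc)
      Set.inter_subset_left
  obtain ⟨η, hη, hηg⟩ := exists_pos_le_of_isCompact hcpt (hg.mono Set.inter_subset_left)
    fun x hx => (hg0 x hx.1).lt_of_ne' fun h0 => (hIcc hx.2).2 ⟨x, ⟨hx.1, h0⟩, rfl⟩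
  have hstay : ∀ᶠ t in atTop, m ≤ W (q t) → m ≤ W (q (t + 1)) := by
    filter_upwards [hinc, hδ.eventually_lt_const hη,
      tendsto_dist_comp_succ hK hq hW hγ0 hstep (half_pos hr)] with t h1 h2 h3 hmt
    by_cases hle : W (q t) ≤ m + r / 2
    · have := hηg (q t) ⟨hq t, hmt, hle⟩
      nlinarith [mul_nonneg (hγ t) (by linarith : 0 ≤ g (q t) - δ t)]
    · linarith [(abs_lt.mp h3).1]
  obtain ⟨T, hT⟩ := eventually_atTop.mp hstay
  obtain ⟨t, htT, ht⟩ := frequently_atTop.mp hgt T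
  have hge : ∀ s ≥ t, m ≤ W (q s) := fun s hs => by
    induction s, hs using Nat.le_induction with
    | base => exact (hm.2.trans ht).le
    | succ s hs ih => exact hT s (htT.trans hs) ih
  obtain ⟨s, hs, hsc⟩ := frequently_atTop.mp hlt t
  linarith [hge s hs, hm.1]

/-- Discrete Lyapunov convergence without summability of the error terms. -/
lemma tendsto_zero_of_lyapunov (hK : IsCompact K) (hq : ∀ t, q t ∈ K)
    (hW : ContinuousOn W K) (hg : ContinuousOn g K) (hg0 : ∀ x ∈ K, 0 ≤ g x)
    (hfin : (W '' {x ∈ K | g x = 0}).Finite)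
    (hγ : ∀ t, 0 ≤ γ t) (hγ0 : Tendsto γ atTop (𝓝 0))
    (hγdiv : Tendsto (fun n => ∑ t ∈ Finset.range n, γ t) atTop atTop)
    (hδ : Tendsto δ atTop (𝓝 0))
    (hstep : ∀ᶠ t in atTop, dist (q (t + 1)) (q t) ≤ γ t)
    (hinc : ∀ᶠ t in atTop, γ t * (g (q t) - δ t) ≤ W (q (t + 1)) - W (q t)) :
    Tendsto (fun t => g (q t)) atTop (𝓝 0) := by
  obtain ⟨c, hc⟩ := exists_tendsto_of_lyapunov hK hq hW hg hg0 hfin hγ hγ0 hδ hstep hinc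
  refine tendsto_order.mpr ⟨fun a ha => .of_forall fun t => ha.trans_le (hg0 _ (hq t)),
    fun a ha => ?_⟩
  obtain ⟨ρ, hρ, hunif⟩ := Metric.uniformContinuousOn_iff.mp
    (hK.uniformContinuousOn_of_continuous hg) (a / 2) (by linarith)
  obtain ⟨N, hN⟩ := Metric.cauchySeq_iff.mp hc.cauchySeq (a / 4 * (ρ / 2)) (by positivity)
  obtain ⟨T, hT⟩ := eventually_atTop.mp ((hδ.eventually_lt_const (show 0 < a / 4 by linarith)).and
    ((hγ0.eventually_lt_const (half_pos hρ)).and (hstep.and (hinc.and (eventually_ge_atTop N)))))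
  refine eventually_atTop.mpr ⟨T, fun t ht => ?_⟩
  by_contra! hat
  have key : ∀ s ≥ t, ∑ k ∈ Finset.Ico t s, γ k < ρ ∧ dist (q s) (q t) ≤ ∑ k ∈ Finset.Ico t s, γ k ∧
      a / 4 * ∑ k ∈ Finset.Ico t s, γ k ≤ W (q s) - W (q t) := fun s hs => by
    induction s, hs using Nat.le_induction with
    | base => simpa using hρ
    | succ s hs ih =>
      obtain ⟨h1, h2, h3⟩ := ih
      obtain ⟨hδs, hγs, hsteps, hincs, hNs⟩ := hT s (ht.trans hs)
      obtain ⟨-, -, -, -, hNt⟩ := hT t ht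
      rw [Finset.sum_Ico_succ_top hs]
      have hclose := hunif _ (hq s) _ (hq t) (h2.trans_lt h1)
      have hgs : a / 2 < g (q s) := by
        rw [Real.dist_eq, abs_lt] at hclose
        linarith [hclose.1]
      have hcau := hN s hNs t hNt
      rw [Real.dist_eq, abs_lt] at hcau
      have hsum : ∑ k ∈ Finset.Ico t s, γ k < ρ / 2 :=
        lt_of_mul_lt_mul_left (h3.trans_lt hcau.2) (by linarith)
      refine ⟨by linarith, ?_, ?_⟩
      · linarith [dist_triangle (q (s + 1)) (q s) (q t)]
      · nlinarith [mul_nonneg (hγ s) (by linarith : 0 ≤ g (q s) - δ s - a / 4)]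
  obtain ⟨s, hs, hst⟩ := ((hγdiv.eventually_ge_atTop (∑ k ∈ Finset.range t, γ k + ρ)).and
    (eventually_ge_atTop t)).exists
  have := (key s hst).1
  rw [Finset.sum_Ico_eq_sub _ hst] at this
  linarith

end Lyapunov

lemma tendsto_infDist_zeros {X : Type*} [PseudoMetricSpace X] {K : Set X} (hK : IsCompact K)
    {g : X → ℝ} (hg : ContinuousOn g K) (hg0 : ∀ x ∈ K, 0 ≤ g x) {q : ℕ → X} (hq : ∀ t, q t ∈ K)
    (hlim : Tendsto (fun t => g (q t)) atTop (𝓝 0)) :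
    Tendsto (fun t => Metric.infDist (q t) {x ∈ K | g x = 0}) atTop (𝓝 0) := by
  refine tendsto_order.mpr ⟨fun a ha => .of_forall fun t => ha.trans_le Metric.infDist_nonneg,
    fun a ha => ?_⟩
  set f := fun x => Metric.infDist x {x ∈ K | g x = 0}
  obtain ⟨η, hη, h⟩ := exists_pos_le_of_isCompact (K := K ∩ f ⁻¹' Set.Ici a)
    (hK.inter_right (isClosed_Ici.preimage (Metric.continuous_infDist_pt _)))
    (hg.mono Set.inter_subset_left) fun x hx => (hg0 x hx.1).lt_of_ne' fun h0 => by
      have : a ≤ f x := hx.2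
      rw [show f x = 0 from Metric.infDist_zero_of_mem ⟨hx.1, h0⟩] at this
      exact ha.not_ge this
  filter_upwards [hlim.eventually_lt_const hη] with t ht
  by_contra! hat
  exact ht.not_ge (h _ ⟨hq t, hat⟩)

lemma exists_abs_prod_add_sub_le {σ : Type*} [DecidableEq σ] (s : Finset σ) :
    ∃ C, 0 ≤ C ∧ ∀ (x d : σ → ℝ) (c : ℝ), (∀ i, |x i| ≤ 1) → (∀ i, |d i| ≤ 1) → 0 ≤ c → c ≤ 1 →
      |∏ i ∈ s, (x i + c * d i) - ∏ i ∈ s, x i - c * ∑ i ∈ s, (∏ j ∈ s.erase i, x j) * d i| ≤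
        C * c ^ 2 := by
  induction s using Finset.induction_on with
  | empty => exact ⟨0, le_rfl, by simp⟩
  | insert a s ha ih =>
    obtain ⟨C, hC0, hC⟩ := ih
    refine ⟨2 * C + s.card, by positivity, fun x d c hx hd hc0 hc1 => ?_⟩
    have hR := hC x d c hx hd hc0 hc1
    set S := ∑ i ∈ s, (∏ j ∈ s.erase i, x j) * d i with hSdef
    have hS : |S| ≤ s.card := by
      refine (Finset.abs_sum_le_sum_abs _ _).trans ?_
      rw [← nsmul_one, ← Finset.sum_const]
      refine Finset.sum_le_sum fun i _ => ?_
      rw [abs_mul, Finset.abs_prod]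
      exact mul_le_one₀ (Finset.prod_le_one (fun _ _ => abs_nonneg _) fun j _ => hx j)
        (abs_nonneg _) (hd i)
    have hsum : ∑ i ∈ insert a s, (∏ j ∈ (insert a s).erase i, x j) * d i =
        (∏ j ∈ s, x j) * d a + x a * S := by
      rw [Finset.sum_insert ha, Finset.erase_insert ha, hSdef, Finset.mul_sum]
      congr 1
      refine Finset.sum_congr rfl fun i hi => ?_
      have hai : a ≠ i := fun h => ha (h ▸ hi)
      rw [Finset.erase_insert_of_ne hai,
        Finset.prod_insert fun h => ha (Finset.mem_of_mem_erase h), mul_assoc]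
    rw [hsum, Finset.prod_insert ha, Finset.prod_insert ha]
    set R := ∏ i ∈ s, (x i + c * d i) - ∏ i ∈ s, x i - c * S
    have hid : (x a + c * d a) * ∏ i ∈ s, (x i + c * d i) - x a * ∏ i ∈ s, x i -
        c * ((∏ i ∈ s, x i) * d a + x a * S) = x a * R + c * (d a * R) + c ^ 2 * (d a * S) := by
      simp only [R]
      ring
    rw [hid]
    have h1 : |x a * R| ≤ C * c ^ 2 := by
      rw [abs_mul]
      exact (mul_le_of_le_one_left (abs_nonneg _) (hx a)).trans hR
    have h2 : |c * (d a * R)| ≤ C * c ^ 2 := by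
      rw [abs_mul, abs_mul, abs_of_nonneg hc0]
      refine (mul_le_of_le_one_left (by positivity) hc1).trans ?_
      exact (mul_le_of_le_one_left (abs_nonneg _) (hd a)).trans hR
    have h3 : |c ^ 2 * (d a * S)| ≤ s.card * c ^ 2 := by
      rw [abs_mul, abs_mul, abs_of_nonneg (sq_nonneg c), mul_comm]
      gcongr
      exact (mul_le_of_le_one_left (abs_nonneg _) (hd a)).trans hS
    refine (abs_add_le _ _).trans ((add_le_add (abs_add_le _ _) le_rfl).trans ?_)
    linarith

/-- First-order expansion of the mixed utility, with a uniform quadratic error. -/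
lemma exists_abs_U_add_smul_sub_le (u : (ι → A) → ℝ) :
    ∃ C, ∀ (p d : ι → A → ℝ) (c : ℝ), (∀ i a, |p i a| ≤ 1) → (∀ i a, |d i a| ≤ 1) →
      0 ≤ c → c ≤ 1 →
      |U u (p + c • d) - U u p - c * ∑ i, U u (Function.update p i (d i))| ≤ C * c ^ 2 := by
  obtain ⟨C, -, hC⟩ := exists_abs_prod_add_sub_le (Finset.univ : Finset ι)
  refine ⟨∑ y, |u y| * C, fun p d c hp hd hc0 hc1 => ?_⟩
  have hid : U u (p + c • d) - U u p - c * ∑ i, U u (Function.update p i (d i)) =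
      ∑ y : ι → A, u y * (∏ i, (p i (y i) + c * d i (y i)) - ∏ i, p i (y i) -
        c * ∑ i, (∏ j ∈ Finset.univ.erase i, p j (y j)) * d i (y i)) := by
    simp only [U_update]
    rw [Finset.sum_comm]
    simp only [U, mul_sub, Finset.sum_sub_distrib, Finset.mul_sum, Pi.add_apply, Pi.smul_apply,
      smul_eq_mul]
    congr 1
    exact Finset.sum_congr rfl fun y _ => Finset.sum_congr rfl fun i _ => by ring
  rw [hid, Finset.sum_mul]
  refine (Finset.abs_sum_le_sum_abs _ _).trans (Finset.sum_le_sum fun y _ => ?_)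
  rw [abs_mul, mul_assoc]
  exact mul_le_mul_of_nonneg_left (hC _ _ c (fun i => hp i _) (fun i => hd i _) hc0 hc1)
    (abs_nonneg _)

lemma U_update_sub (u : (ι → A) → ℝ) (p : ι → A → ℝ) (i : ι) (α β : A → ℝ) :
    U u (Function.update p i (α - β)) =
      U u (Function.update p i α) - U u (Function.update p i β) := by
  simp only [U_update, ← Finset.sum_sub_distrib, Pi.sub_apply]
  exact Finset.sum_congr rfl fun y _ => by ring

lemma le_one_of_mem_simplex {B : Type*} {Y : Finset B} {α : B → ℝ} (h : α ∈ simplex Y) (a : B) :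
    α a ≤ 1 := by
  by_cases ha : a ∈ Y
  · rw [← h.2.2]
    exact Finset.single_le_sum (fun b _ => h.1 b) ha
  · rw [h.2.1 a ha]
    exact zero_le_one

lemma abs_sub_le_one_of_mem_simplex {B : Type*} {Y : Finset B} {α β : B → ℝ} (hα : α ∈ simplex Y)
    (hβ : β ∈ simplex Y) (a : B) : |α a - β a| ≤ 1 := by
  rw [abs_le]
  constructor <;>
    linarith [hα.1 a, hβ.1 a, le_one_of_mem_simplex hα a, le_one_of_mem_simplex hβ a]

lemma isCompact_simplex {B : Type*} (Y : Finset B) : IsCompact (simplex Y) := by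
  refine (isCompact_univ_pi fun _ : B => isCompact_Icc (a := (0 : ℝ)) (b := 1)).of_isClosed_subset
    ?_ fun α hα a _ => ⟨hα.1 a, le_one_of_mem_simplex hα a⟩
  simp only [simplex, Set.ofPred_and, Set.ofPred_forall]
  refine (isClosed_iInter fun a => isClosed_le continuous_const (continuous_apply a)).inter
    ((isClosed_iInter fun a => isClosed_iInter fun _ =>
      isClosed_eq (continuous_apply a) continuous_const).inter (isClosed_eq ?_ continuous_const))
  exact continuous_finsetSum _ fun a _ => continuous_apply a

lemma isCompact_Delta {I B : Type*} (Y : I → Finset B) : IsCompact (Delta Y) := by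
  convert isCompact_univ_pi fun i => isCompact_simplex (Y i)
  ext p
  simp [Delta]

lemma continuous_U (u : (ι → A) → ℝ) : Continuous (U u) := by
  unfold U
  fun_prop

lemma mem_cluster {I : Type*} [Fintype I] {cls : I → κ} {i j : I} :
    j ∈ cluster cls i ↔ cls j = cls i := by
  simp [cluster]

lemma cluster_card_pos {I : Type*} [Fintype I] (cls : I → κ) (i : I) :
    0 < ((cluster cls i).card : ℝ) :=
  Nat.cast_pos.mpr (Finset.card_pos.mpr ⟨i, mem_cluster.mpr rfl⟩)

lemma cluster_eq {I : Type*} [Fintype I] {cls : I → κ} {i j : I} (h : cls i = cls j) :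
    cluster cls i = cluster cls j := by
  simp [cluster, h]

lemma classConst_centroid {I B : Type*} [Fintype I] (cls : I → κ) (p : I → B → ℝ) :
    classConst cls (centroid cls p) := fun i j h => by
  simp [centroid, cluster_eq h]

lemma continuous_centroid {I B : Type*} [Fintype I] (cls : I → κ) :
    Continuous (centroid cls : (I → B → ℝ) → I → B → ℝ) := by
  unfold centroid
  fun_prop

lemma centroid_add_smul_sub {I B : Type*} [Fintype I] (cls : I → κ) (q a : I → B → ℝ) (c : ℝ) :
    centroid cls (q + c • (a - q)) =
      centroid cls q + c • (centroid cls a - centroid cls q) := by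
  funext i
  simp only [centroid, Pi.add_apply, Pi.smul_apply, Pi.sub_apply, Finset.sum_add_distrib,
    ← Finset.smul_sum, Finset.sum_sub_distrib]
  module

lemma convex_simplex {B : Type*} (Y : Finset B) : Convex ℝ (simplex Y) := by
  intro α hα β hβ s t hs ht hst
  refine ⟨fun a => ?_, fun a ha => ?_, ?_⟩
  · exact add_nonneg (mul_nonneg hs (hα.1 a)) (mul_nonneg ht (hβ.1 a))
  · simp [hα.2.1 a ha, hβ.2.1 a ha]
  · simp [Finset.sum_add_distrib, ← Finset.mul_sum, hα.2.2, hβ.2.2, hst]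

section Partition

variable {Y : ι → Finset A} {u : (ι → A) → ℝ} {cls : ι → κ}

lemma centroid_mem_Delta (hpi : PermInvariant Y u cls) {p : ι → A → ℝ} (hp : p ∈ Delta Y) :
    centroid cls p ∈ Delta Y := fun i => by
  rw [centroid, Finset.smul_sum]
  refine (convex_simplex (Y i)).sum_mem (fun _ _ => inv_nonneg.mpr (cluster_card_pos cls i).le) ?_
    fun j hj => (hpi j i (mem_cluster.mp hj)).1 ▸ hp j
  rw [Finset.sum_const, nsmul_eq_mul, mul_inv_cancel₀ (cluster_card_pos cls i).ne']

lemma U_comp_swap (hpi : PermInvariant Y u cls) {p : ι → A → ℝ} (hp : p ∈ Delta Y) {i j : ι}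
    (hij : cls i = cls j) : U u (p ∘ Equiv.swap i j) = U u p := by
  unfold U
  rw [← (Equiv.arrowCongr (Equiv.swap i j) (Equiv.refl A)).sum_comp]
  refine Finset.sum_congr rfl fun y _ => ?_
  have hy : Equiv.arrowCongr (Equiv.swap i j) (Equiv.refl A) y = y ∘ Equiv.swap i j := by
    ext k
    simp
  have hprod : ∏ k, (p ∘ Equiv.swap i j) k ((y ∘ Equiv.swap i j) k) = ∏ k, p k (y k) :=
    Equiv.prod_comp (Equiv.swap i j) fun k => p k (y k)
  rw [hy, hprod]
  by_cases h : ∀ k, y k ∈ Y k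
  · rw [← (hpi i j hij).2 y h]
    congr 2
    ext k
    rcases eq_or_ne k j with rfl | hkj
    · simp [swapStrat]
    rcases eq_or_ne k i with rfl | hki
    · simp [swapStrat, hkj]
    · simp [swapStrat, hkj, hki, Equiv.swap_apply_of_ne_of_ne]
  · push Not at h
    obtain ⟨k, hk⟩ := h
    rw [Finset.prod_eq_zero (Finset.mem_univ k) ((hp k).2.1 _ hk)]
    simp

lemma U_update_eq_of_cls_eq (hpi : PermInvariant Y u cls) {p : ι → A → ℝ} (hp : p ∈ Delta Y)
    (hconst : classConst cls p) {i j : ι} (hij : cls i = cls j) {α : A → ℝ}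
    (hα : α ∈ simplex (Y i)) :
    U u (Function.update p i α) = U u (Function.update p j α) := by
  have hmem : Function.update p i α ∈ Delta Y := fun k => by
    rcases eq_or_ne k i with rfl | hk
    · simpa using hα
    · simpa [hk] using hp k
  rw [← U_comp_swap hpi hmem hij]
  congr 1
  ext k
  rcases eq_or_ne k j with rfl | hkj
  · simp
  rcases eq_or_ne k i with rfl | hki
  · simp [Ne.symm hkj, hkj, hconst k j hij]
  · simp [Equiv.swap_apply_of_ne_of_ne, hki, hkj]

lemma U_update_centroid (p q : ι → A → ℝ) (i : ι) :
    U u (Function.update p i (centroid cls q i)) =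
      ((cluster cls i).card : ℝ)⁻¹ * ∑ j ∈ cluster cls i, U u (Function.update p i (q j)) := by
  simp only [U_update, centroid, Pi.smul_apply, Finset.sum_apply, smul_eq_mul]
  rw [Finset.sum_comm, Finset.mul_sum]
  simp only [Finset.mul_sum]
  exact Finset.sum_congr rfl fun y _ => Finset.sum_congr rfl fun j _ => by ring

/-- Averaging deviations over classes does not change the total payoff of unilateral deviations. -/
lemma sum_U_update_centroid (hpi : PermInvariant Y u cls) {p b : ι → A → ℝ} (hp : p ∈ Delta Y)
    (hconst : classConst cls p) (hb : b ∈ Delta Y) :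
    ∑ i, U u (Function.update p i (centroid cls b i)) = ∑ i, U u (Function.update p i (b i)) := by
  have h : ∀ i, U u (Function.update p i (centroid cls b i)) =
      ∑ j, if cls j = cls i then
        ((cluster cls j).card : ℝ)⁻¹ * U u (Function.update p j (b j)) else 0 := fun i => by
    rw [U_update_centroid, Finset.mul_sum, cluster, Finset.sum_filter]
    refine Finset.sum_congr rfl fun j _ => ?_
    split_ifs with hji
    · rw [← U_update_eq_of_cls_eq hpi hp hconst hji (hb j), ← cluster, cluster_eq hji]
    · rfl
  simp only [h]
  rw [Finset.sum_comm]
  refine Finset.sum_congr rfl fun j _ => ?_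
  rw [← Finset.sum_filter, Finset.sum_const, nsmul_eq_mul, ← mul_assoc]
  have : Finset.univ.filter (fun i => cls j = cls i) = cluster cls j := by
    simp [cluster, eq_comm]
  rw [this, mul_inv_cancel₀ (cluster_card_pos cls j).ne', one_mul]

lemma centroid_mem_NE (hpi : PermInvariant Y u cls) {p : ι → A → ℝ} (hp : p ∈ MCE Y u cls) :
    centroid cls p ∈ NE Y u := by
  have hmem := centroid_mem_Delta hpi hp.1
  refine ⟨hmem, fun i α hα => ?_⟩
  rw [U_eq_update_self u (centroid cls p) i, U_update_centroid, le_inv_mul_iff₀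
    (cluster_card_pos cls i), ← nsmul_eq_mul, ← Finset.sum_const]
  refine Finset.sum_le_sum fun j hj => ?_
  have hji := mem_cluster.mp hj
  have hY := (hpi j i hji).1
  rw [U_update_eq_of_cls_eq hpi hmem (classConst_centroid cls p) hji.symm hα,
    U_update_eq_of_cls_eq hpi hmem (classConst_centroid cls p) hji.symm (hY ▸ hp.1 j)]
  exact hp.2 j α (hY ▸ hα)

end Partition

section Gap

variable [DecidableEq A] {Y : ι → Finset A} {hY : ∀ i, (Y i).Nonempty} {u : (ι → A) → ℝ}
  {cls : ι → κ}

lemma U_update_le_sup_payoff (p : ι → A → ℝ) {i : ι} (hYi : (Y i).Nonempty) {α : A → ℝ}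
    (hα : α ∈ simplex (Y i)) :
    U u (Function.update p i α) ≤ (Y i).sup' hYi (payoff u p i) := by
  rw [U_update_eq_sum_payoff, ← one_mul ((Y i).sup' _ _), ← simplex_sum_univ hα, Finset.sum_mul]
  refine Finset.sum_le_sum fun a _ => ?_
  by_cases ha : a ∈ Y i
  · exact mul_le_mul_of_nonneg_left (Finset.le_sup' _ ha) (hα.1 a)
  · simp [hα.2.1 a ha]

variable (Y hY u cls) in
/-- The total regret of `q` against its centroid; it vanishes exactly at mean-centric equilibria. -/
def regret (q : ι → A → ℝ) : ℝ :=
  ∑ i, ((Y i).sup' (hY i) (payoff u (centroid cls q) i) -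
    U u (Function.update (centroid cls q) i (q i)))

lemma continuous_regret : Continuous (regret Y hY u cls) := by
  unfold regret payoff
  have hc := continuous_centroid (B := A) cls
  refine continuous_finsetSum _ fun i _ => .sub ?_ ?_
  · exact Continuous.finset_sup'_apply _ fun a _ =>
      (continuous_U u).comp (hc.update i continuous_const)
  · exact (continuous_U u).comp (hc.update i (continuous_apply i))

lemma regret_nonneg {q : ι → A → ℝ} (hq : q ∈ Delta Y) : 0 ≤ regret Y hY u cls q :=
  Finset.sum_nonneg fun i _ => sub_nonneg.mpr (U_update_le_sup_payoff _ _ (hq i))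

lemma setOf_regret_eq_zero : {q ∈ Delta Y | regret Y hY u cls q = 0} = MCE Y u cls := by
  ext q
  refine and_congr_right fun hq => ?_
  rw [regret, Finset.sum_eq_zero_iff_of_nonneg
    fun i _ => sub_nonneg.mpr (U_update_le_sup_payoff _ _ (hq i))]
  simp only [Finset.mem_univ, true_imp_iff, sub_eq_zero]
  refine forall_congr' fun i => ⟨fun h α hα => ?_, fun h => ?_⟩
  · exact h ▸ U_update_le_sup_payoff _ _ hα
  · exact le_antisymm (Finset.sup'_le _ _ fun a ha => h _ (single_mem_simplex ha))
      (U_update_le_sup_payoff _ _ (hq i))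

lemma regret_sub_le (hpi : PermInvariant Y u cls) {q a : ι → A → ℝ} (hq : q ∈ Delta Y) {ε : ℝ}
    (ha : a ∈ BR Y u ε (centroid cls q)) :
    regret Y hY u cls q - Fintype.card ι * ε ≤
      ∑ i, U u (Function.update (centroid cls q) i (centroid cls a i - centroid cls q i)) := by
  have hmem := centroid_mem_Delta hpi hq
  have hconst := classConst_centroid cls q
  simp only [U_update_sub]
  rw [Finset.sum_sub_distrib, sum_U_update_centroid hpi hmem hconst fun i => (ha i).1,
    sum_U_update_centroid hpi hmem hconst hq, regret, Finset.sum_sub_distrib]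
  have : ∑ i, (Y i).sup' (hY i) (payoff u (centroid cls q) i) ≤
      ∑ i, (U u (Function.update (centroid cls q) i (a i)) + ε) :=
    Finset.sum_le_sum fun i _ => Finset.sup'_le _ _ fun b hb =>
      sub_le_iff_le_add.mp ((ha i).2 _ (single_mem_simplex hb))
  rw [Finset.sum_add_distrib, Finset.sum_const, Finset.card_univ, nsmul_eq_mul] at this
  linarith

end Gap

variable [Nonempty ι]

/-- **Theorem 1(i).** In any discrete-time ECFP process (step sizes `γ_t ≥ 0`,
`∑ γ_t = ∞`, `γ_t → 0`; perturbations `ε_t → 0`) for an identical-interests game with a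
permutation-invariant partition, the empirical distributions learn mean-centric equilibria:
`dist(q(t), MCE) → 0`. -/
theorem ecfp_empirical_learns_MCE
    (Y : ι → Finset A) (hY : ∀ i, (Y i).Nonempty) (u : (ι → A) → ℝ)
    (cls : ι → κ) (hpi : PermInvariant Y u cls)
    (γ ε : ℕ → ℝ) (a q : ℕ → ι → A → ℝ)
    (hproc : IsECFP Y u cls γ ε a q)
    (hγnonneg : ∀ t, 0 ≤ γ t)
    (hγdiv : Tendsto (fun n => ∑ t ∈ Finset.range n, γ t) atTop atTop)
    (hγ0 : Tendsto γ atTop (𝓝 0))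
    (hεnonneg : ∀ t, 0 ≤ ε t)
    (hε0 : Tendsto ε atTop (𝓝 0)) :
    Tendsto (fun t => Metric.infDist (q t) (MCE Y u cls)) atTop (𝓝 0) := by
  classical
  have hmemA : ∀ t, a (t + 1) ∈ Delta Y := fun t i => (hproc.br t i).1
  obtain ⟨C, hC⟩ := exists_abs_U_add_smul_sub_le u
  have hlim : Tendsto (fun t => regret Y hY u cls (q t)) atTop (𝓝 0) := by
    refine tendsto_zero_of_lyapunov (isCompact_Delta Y) hproc.q_mem
      (W := fun p => U u (centroid cls p)) (δ := fun t => Fintype.card ι * ε t + C * γ t)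
      ((continuous_U u).comp (continuous_centroid cls)).continuousOn
      continuous_regret.continuousOn (fun p hp => regret_nonneg hp) ?_ hγnonneg hγ0 hγdiv
      (by simpa using (hε0.const_mul (Fintype.card ι : ℝ)).add (hγ0.const_mul C))
      (.of_forall fun t => ?_) ?_
    · rw [setOf_regret_eq_zero]
      refine (finite_image_U_NE Y u).subset ?_
      rintro _ ⟨p, hp, rfl⟩
      exact ⟨_, centroid_mem_NE hpi hp, rfl⟩
    · rw [hproc.step, dist_self_add_left, norm_smul, Real.norm_of_nonneg (hγnonneg t)]
      refine mul_le_of_le_one_right (hγnonneg t) ?_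
      refine (pi_norm_le_iff_of_nonneg zero_le_one).mpr fun i =>
        (pi_norm_le_iff_of_nonneg zero_le_one).mpr fun b => ?_
      exact abs_sub_le_one_of_mem_simplex (hmemA t i) (hproc.q_mem t i) b
    · filter_upwards [hγ0.eventually_le_const one_pos] with t ht
      have hy := centroid_mem_Delta hpi (hproc.q_mem t)
      have hb := centroid_mem_Delta hpi (hmemA t)
      have hexp := hC (centroid cls (q t)) (centroid cls (a (t + 1)) - centroid cls (q t)) (γ t)
        (fun i c => abs_le.mpr ⟨by linarith [(hy i).1 c], le_one_of_mem_simplex (hy i) c⟩)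
        (fun i => abs_sub_le_one_of_mem_simplex (hb i) (hy i)) (hγnonneg t) ht
      rw [← centroid_add_smul_sub, ← hproc.step] at hexp
      have hreg := mul_le_mul_of_nonneg_left
        (regret_sub_le (hY := hY) hpi (hproc.q_mem t) (hproc.br t)) (hγnonneg t)
      have := (abs_le.mp hexp).1
      simp only [Pi.sub_apply] at this
      linarith
  rw [← setOf_regret_eq_zero (hY := hY)]
  exact tendsto_infDist_zeros (isCompact_Delta Y) continuous_regret.continuousOn
    (fun p hp => regret_nonneg hp) hproc.q_mem hlim

end ECFP
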